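/- arXiv:0903.4872 — 6 statements merged into one kernel-verified Lean document; each statement's English description precedes it below -/
import Mathlib

section
/- Let Φ be a set of transformations of a nonempty set A closed under composition and intersection (a ∩-semigroup of transformations), regarded as an algebraic system with product f·g := g∘f, meet ∩, and the semiadjacency relation δ_Φ = {(f,g) : pr₂ f ⊆ pr₁ g}. Then for every subset H_Φ ⊆ Φ and every φ in the f-closure f(H_Φ), one has ⋂_{ψ ∈ H_Φ} pr₁ ψ ⊆ pr₁ φ; more precisely, for every n ≥ 0, φ ∈ Fₙ(H_Φ) implies ⋂_{ψ ∈ H_Φ} pr₁ ψ ⊆ pr₁ φ. -/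
/-- `act mul g x` is the product `g·x` where `x` ranges over `G* = G ∪ {e}`
(`none` playing the role of the adjoined identity `e`, so `g·e = g`). -/
def act {G : Type*} (mul : G → G → G) (g : G) : Option G → G
  | none => g
  | some h => mul g h

/-- `rel δ g y` means `g ⊢ y` where `y` ranges over `G* = G ∪ {e}`
(by definition `g ⊢ e` holds for every `g`). -/
def rel {G : Type*} (δ : G → G → Prop) (g : G) : Option G → Prop
  | none => True
  | some h => δ g h

/-- The natural order of the semilattice `(G,⋏)`: `a ≤ b ↔ a⋏b = a`. -/
def sle {G : Type*} (meet : G → G → G) (a b : G) : Prop := meet a b = a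

/-- `F₁(H) = {z ∈ G | ∃ u,v,w ∈ G, ∃ x,y,t ∈ G*,
(u⋏v⋏w)x ⊢ y ∧ (u⋏v⋏w)xy ≤ zt ∧ u⋏v ∈ H ∧ (v⋏w)x ∈ H}`. -/
def F1 {G : Type*} (mul meet : G → G → G) (δ : G → G → Prop) (H : Set G) : Set G :=
  {z | ∃ u v w : G, ∃ x y t : Option G,
    rel δ (act mul (meet (meet u v) w) x) y ∧
    sle meet (act mul (act mul (meet (meet u v) w) x) y) (act mul z t) ∧
    meet u v ∈ H ∧ act mul (meet v w) x ∈ H}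

/-- The iterated sets `Fₙ(H)`: `F₀(H) = H` and `Fₙ(H) = F₁(F_{n-1}(H))`. -/
def FIter {G : Type*} (mul meet : G → G → G) (δ : G → G → Prop) : ℕ → Set G → Set G
  | 0, H => H
  | n + 1, H => F1 mul meet δ (FIter mul meet δ n H)

/-- `H` is f-closed: for all x,y,t ∈ G* and z,u,v,w ∈ G,
(u⋏v⋏w)x ⊢ y, (u⋏v⋏w)xy ≤ zt, u⋏v ∈ H and (v⋏w)x ∈ H imply z ∈ H. -/
def FClosed {G : Type*} (mul meet : G → G → G) (δ : G → G → Prop) (H : Set G) : Prop :=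
  ∀ (x y t : Option G) (z u v w : G),
    rel δ (act mul (meet (meet u v) w) x) y →
    sle meet (act mul (act mul (meet (meet u v) w) x) y) (act mul z t) →
    meet u v ∈ H → act mul (meet v w) x ∈ H → z ∈ H

/-- `fcl H` is the f-closure of `H`: the smallest f-closed subset of `G` containing `H`
(the intersection of all f-closed sets containing `H`). -/
def fcl {G : Type*} (mul meet : G → G → G) (δ : G → G → Prop) (H : Set G) : Set G :=
  ⋂₀ {K | FClosed mul meet δ K ∧ H ⊆ K}

/-- A transformation (partial map) of `A`, viewed as a binary relation. -/
def IsTransformation {A : Type*} (f : Set (A × A)) : Prop :=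
  ∀ ⦃a b c : A⦄, (a, b) ∈ f → (a, c) ∈ f → b = c

/-- Composition of binary relations: `comp g f = g ∘ f`. -/
def comp {A : Type*} (g f : Set (A × A)) : Set (A × A) :=
  {p | ∃ b, (p.1, b) ∈ f ∧ (b, p.2) ∈ g}

/-- The domain of a binary relation. -/
def pr1 {A : Type*} (f : Set (A × A)) : Set A := {a | ∃ b, (a, b) ∈ f}

/-- The image of a binary relation. -/
def pr2 {A : Type*} (f : Set (A × A)) : Set A := {b | ∃ a, (a, b) ∈ f}

theorem FIter_subset_of_FClosed {G : Type*} {mul meet : G → G → G} {δ : G → G → Prop}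
    {H K : Set G} (hK : FClosed mul meet δ K) (hH : H ⊆ K) (n : ℕ) :
    FIter mul meet δ n H ⊆ K := by
  induction n with
  | zero => exact hH
  | succ n ih =>
    rintro z ⟨u, v, w, x, y, t, hxy, hle, huv, hvw⟩
    exact hK x y t z u v w hxy hle (ih huv) (ih hvw)

/-- The transformations whose domain contains a fixed set `S` form an f-closed set. -/
theorem FClosed_setOf_subset_pr1 {A : Type*} {Φ : Set (Set (A × A))}
    (htr : ∀ f ∈ Φ, IsTransformation f)
    (hcomp : ∀ f ∈ Φ, ∀ g ∈ Φ, comp g f ∈ Φ)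
    (hinter : ∀ f ∈ Φ, ∀ g ∈ Φ, f ∩ g ∈ Φ) (S : Set A) :
    FClosed (fun f g : ↥Φ => (⟨comp g.1 f.1, hcomp f.1 f.2 g.1 g.2⟩ : ↥Φ))
      (fun f g => ⟨f.1 ∩ g.1, hinter f.1 f.2 g.1 g.2⟩)
      (fun f g => pr2 f.1 ⊆ pr1 g.1) {φ : ↥Φ | S ⊆ pr1 φ.1} := by
  intro x y t z u v w hxy hle huv hvw a ha
  obtain ⟨b, hbu, hbv⟩ := huv ha
  have hx : a ∈ pr1 (act (fun f g : ↥Φ => (⟨comp g.1 f.1, hcomp f.1 f.2 g.1 g.2⟩ : ↥Φ))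
      ⟨(u.1 ∩ v.1) ∩ w.1, hinter _ (hinter _ u.2 _ v.2) _ w.2⟩ x).1 := by
    cases x with
    | none =>
      obtain ⟨b', hv, hw⟩ := hvw ha
      obtain rfl := htr v.1 v.2 hbv hv
      exact ⟨b, ⟨hbu, hbv⟩, hw⟩
    | some x =>
      obtain ⟨c, b', ⟨hv, hw⟩, hc⟩ := hvw ha
      obtain rfl := htr v.1 v.2 hbv hv
      exact ⟨c, b, ⟨⟨hbu, hbv⟩, hw⟩, hc⟩
  have hy : a ∈ pr1 (act (fun f g : ↥Φ => (⟨comp g.1 f.1, hcomp f.1 f.2 g.1 g.2⟩ : ↥Φ))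
      (act (fun f g : ↥Φ => (⟨comp g.1 f.1, hcomp f.1 f.2 g.1 g.2⟩ : ↥Φ))
        ⟨(u.1 ∩ v.1) ∩ w.1, hinter _ (hinter _ u.2 _ v.2) _ w.2⟩ x) y).1 := by
    cases y with
    | none => exact hx
    | some y =>
      obtain ⟨c, hc⟩ := hx
      obtain ⟨d, hd⟩ := hxy ⟨a, hc⟩
      exact ⟨d, c, hc, hd⟩
  obtain ⟨d, hd⟩ := hy
  have hzt := (Set.inter_eq_left.mp (congrArg Subtype.val hle)) hd
  cases t with
  | none => exact ⟨d, hzt⟩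
  | some t =>
    obtain ⟨c, hc, -⟩ := hzt
    exact ⟨c, hc⟩

/-- In a ∩-semigroup `(Φ,∘,∩,δ_Φ)` of transformations (product `f·g := g∘f`, meet `∩`,
`f ⊢ g ⟺ pr₂ f ⊆ pr₁ g`), for every `H_Φ ⊆ Φ` and every `φ` in the f-closure `f(H_Φ)`
one has `⋂_{ψ ∈ H_Φ} pr₁ ψ ⊆ pr₁ φ`; more precisely `φ ∈ Fₙ(H_Φ)` implies the same
inclusion for every `n ≥ 0`. -/
theorem statement_12 {A : Type*} [Nonempty A] (Φ : Set (Set (A × A)))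
    (htr : ∀ f ∈ Φ, IsTransformation f)
    (hcomp : ∀ f ∈ Φ, ∀ g ∈ Φ, comp g f ∈ Φ)
    (hinter : ∀ f ∈ Φ, ∀ g ∈ Φ, f ∩ g ∈ Φ) :
    ∀ (H : Set ↥Φ) (φ : ↥Φ),
      (φ ∈ fcl (fun f g => ⟨comp g.1 f.1, hcomp f.1 f.2 g.1 g.2⟩)
          (fun f g => ⟨f.1 ∩ g.1, hinter f.1 f.2 g.1 g.2⟩)
          (fun f g => pr2 f.1 ⊆ pr1 g.1) H →
        (⋂ ψ ∈ H, pr1 (ψ : ↥Φ).1) ⊆ pr1 φ.1) ∧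
      (∀ n : ℕ, φ ∈ FIter (fun f g => ⟨comp g.1 f.1, hcomp f.1 f.2 g.1 g.2⟩)
          (fun f g => ⟨f.1 ∩ g.1, hinter f.1 f.2 g.1 g.2⟩)
          (fun f g => pr2 f.1 ⊆ pr1 g.1) n H →
        (⋂ ψ ∈ H, pr1 (ψ : ↥Φ).1) ⊆ pr1 φ.1) := by
  intro H φ
  have hK := FClosed_setOf_subset_pr1 htr hcomp hinter (⋂ ψ ∈ H, pr1 (ψ : ↥Φ).1)
  have hH : H ⊆ {φ : ↥Φ | (⋂ ψ ∈ H, pr1 (ψ : ↥Φ).1) ⊆ pr1 φ.1} :=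
    fun _ hψ => Set.biInter_subset_of_mem hψ
  exact ⟨fun hφ => hφ _ ⟨hK, hH⟩, fun n hφ => FIter_subset_of_FClosed hK hH n hφ⟩
end

section
/- A subset H of G is f-closed if and only if it satisfies the following four conditions: (i) xy ∈ H implies x ∈ H; (ii) g₁ ⊢ g₂ and g₁ ∈ H imply g₁g₂ ∈ H; (iii) g₁⋏g₂ = g₁ ∈ H implies g₂ ∈ H (i.e. H is upward closed with respect to ≤); (iv) g₁⋏g₂ ∈ H and (g₂⋏g₃)x ∈ H imply (g₁⋏g₂⋏g₃)x ∈ H, for all g₁,g₂,g₃ ∈ G and x ∈ G*. -/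
/-- A subset `H ⊆ G` is f-closed iff: (i) `xy ∈ H → x ∈ H`; (ii) `g₁ ⊢ g₂` and
`g₁ ∈ H` imply `g₁g₂ ∈ H`; (iii) `g₁⋏g₂ = g₁ ∈ H` implies `g₂ ∈ H`; and
(iv) `g₁⋏g₂ ∈ H` and `(g₂⋏g₃)x ∈ H` imply `(g₁⋏g₂⋏g₃)x ∈ H` for all `x ∈ G*`. -/
theorem statement_13 {G : Type*} (mul meet : G → G → G) (δ : G → G → Prop)
    (hassoc : ∀ a b c, mul (mul a b) c = mul a (mul b c))
    (hcomm : ∀ a b, meet a b = meet b a)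
    (hmassoc : ∀ a b c, meet (meet a b) c = meet a (meet b c))
    (hidem : ∀ a, meet a a = a)
    (hli : ∀ x y u, δ x y → δ (mul u x) y)
    (hdist : ∀ x y z, mul x (meet y z) = meet (mul x y) (mul x z))
    (hmle : ∀ x y z, sle meet (mul (meet x y) z) (mul y z)) :
    ∀ H : Set G, FClosed mul meet δ H ↔
      ((∀ x y : G, mul x y ∈ H → x ∈ H) ∧
       (∀ g₁ g₂ : G, δ g₁ g₂ → g₁ ∈ H → mul g₁ g₂ ∈ H) ∧
       (∀ g₁ g₂ : G, meet g₁ g₂ = g₁ → g₁ ∈ H → g₂ ∈ H) ∧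
       (∀ (g₁ g₂ g₃ : G) (x : Option G), meet g₁ g₂ ∈ H →
         act mul (meet g₂ g₃) x ∈ H → act mul (meet (meet g₁ g₂) g₃) x ∈ H)) := by
  intro H
  constructor
  · intro hH
    have of_mem : ∀ (g z : G) (y t : Option G), g ∈ H → rel δ g y →
        sle meet (act mul g y) (act mul z t) → z ∈ H := by
      intro g z y t hg hy hle
      refine hH none y t z g g g ?_ ?_ ?_ ?_ <;> simpa only [act, hidem]
    refine ⟨fun x y h => of_mem (mul x y) x none (some y) h trivial (hidem _),
      fun g₁ g₂ h hg => of_mem g₁ (mul g₁ g₂) (some g₂) none hg h (hidem _),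
      fun g₁ g₂ h hg => of_mem g₁ g₂ none none hg trivial h, ?_⟩
    intro g₁ g₂ g₃ x h₁ h₂
    exact hH x none none _ g₁ g₂ g₃ trivial (hidem _) h₁ h₂
  · rintro ⟨hleft, hrel, hup, hmeet⟩ x y t z u v w hy hle huv hvw
    have hp := hmeet u v w x huv hvw
    have hpy : act mul (act mul (meet (meet u v) w) x) y ∈ H := by
      cases y with
      | none => exact hp
      | some y => exact hrel _ _ hy hp
    have hzt := hup _ _ hle hpy
    cases t with
    | none => exact hzt
    | some t => exact hleft _ _ hzt
end

section
/- For every subset H ⊆ G, every element z ∈ G and every n ≥ 0, one has z·Fₙ(H) ⊆ Fₙ(z·H), where z·S denotes {z·s : s ∈ S}. -/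
theorem mul_act {G : Type*} {mul : G → G → G}
    (hassoc : ∀ a b c, mul (mul a b) c = mul a (mul b c)) (z g : G) (x : Option G) :
    mul z (act mul g x) = act mul (mul z g) x := by
  cases x with
  | none => rfl
  | some h => exact (hassoc z g h).symm

theorem rel_mul_left {G : Type*} {mul : G → G → G} {δ : G → G → Prop}
    (hli : ∀ x y u, δ x y → δ (mul u x) y) (z : G) {g : G} {y : Option G}
    (h : rel δ g y) : rel δ (mul z g) y := by
  cases y with
  | none => trivial
  | some y => exact hli g y z h

theorem sle_mul_left {G : Type*} {mul meet : G → G → G}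
    (hdist : ∀ x y z, mul x (meet y z) = meet (mul x y) (mul x z)) (z : G) {a b : G}
    (h : sle meet a b) : sle meet (mul z a) (mul z b) := by
  unfold sle at h ⊢
  rw [← hdist, h]

theorem F1_mono {G : Type*} (mul meet : G → G → G) (δ : G → G → Prop) :
    Monotone (F1 mul meet δ) := by
  rintro H K hHK s ⟨u, v, w, x, y, t, hr, hs, h₁, h₂⟩
  exact ⟨u, v, w, x, y, t, hr, hs, hHK h₁, hHK h₂⟩

theorem image_mul_F1_subset {G : Type*} {mul meet : G → G → G} {δ : G → G → Prop}
    (hassoc : ∀ a b c, mul (mul a b) c = mul a (mul b c))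
    (hli : ∀ x y u, δ x y → δ (mul u x) y)
    (hdist : ∀ x y z, mul x (meet y z) = meet (mul x y) (mul x z)) (H : Set G) (z : G) :
    mul z '' F1 mul meet δ H ⊆ F1 mul meet δ (mul z '' H) := by
  rintro _ ⟨s, ⟨u, v, w, x, y, t, hr, hs, h₁, h₂⟩, rfl⟩
  refine ⟨mul z u, mul z v, mul z w, x, y, t, ?_, ?_, ?_, ?_⟩
  · simpa only [mul_act hassoc, hdist] using rel_mul_left hli z hr
  · simpa only [mul_act hassoc, hdist] using sle_mul_left hdist z hs
  · exact ⟨_, h₁, hdist z u v⟩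
  · exact ⟨_, h₂, by rw [mul_act hassoc, hdist]⟩

/-- `z·Fₙ(H) ⊆ Fₙ(z·H)` for every `H ⊆ G`, `z ∈ G` and `n ≥ 0`, where
`z·S = {z·s : s ∈ S}`. -/
theorem statement_14 {G : Type*} (mul meet : G → G → G) (δ : G → G → Prop)
    (hassoc : ∀ a b c, mul (mul a b) c = mul a (mul b c))
    (hcomm : ∀ a b, meet a b = meet b a)
    (hmassoc : ∀ a b c, meet (meet a b) c = meet a (meet b c))
    (hidem : ∀ a, meet a a = a)
    (hli : ∀ x y u, δ x y → δ (mul u x) y)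
    (hdist : ∀ x y z, mul x (meet y z) = meet (mul x y) (mul x z))
    (hmle : ∀ x y z, sle meet (mul (meet x y) z) (mul y z)) :
    ∀ (H : Set G) (z : G) (n : ℕ),
      (mul z) '' (FIter mul meet δ n H) ⊆ FIter mul meet δ n ((mul z) '' H) := by
  intro H z n
  induction n with
  | zero => exact subset_rfl
  | succ n ih =>
    exact (image_mul_F1_subset hassoc hli hdist _ z).trans (F1_mono mul meet δ ih)
end

section
/- For every subset H ⊆ G and every element z ∈ G, one has z·f(H) ⊆ f(z·H), where z·S denotes {z·s : s ∈ S} and f(H) is the f-closure of H. -/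
/-- `z·f(H) ⊆ f(z·H)` for every `H ⊆ G` and `z ∈ G`, where `z·S = {z·s : s ∈ S}`
and `f(H)` is the f-closure of `H`. -/
theorem statement_15 {G : Type*} (mul meet : G → G → G) (δ : G → G → Prop)
    (hassoc : ∀ a b c, mul (mul a b) c = mul a (mul b c))
    (hcomm : ∀ a b, meet a b = meet b a)
    (hmassoc : ∀ a b c, meet (meet a b) c = meet a (meet b c))
    (hidem : ∀ a, meet a a = a)
    (hli : ∀ x y u, δ x y → δ (mul u x) y)
    (hdist : ∀ x y z, mul x (meet y z) = meet (mul x y) (mul x z))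
    (hmle : ∀ x y z, sle meet (mul (meet x y) z) (mul y z)) :
    ∀ (H : Set G) (z : G),
      (mul z) '' (fcl mul meet δ H) ⊆ fcl mul meet δ ((mul z) '' H) := by
  intro H z
  have hact : ∀ (a : G) (x : Option G), mul z (act mul a x) = act mul (mul z a) x := by
    rintro a (_ | x)
    · rfl
    · exact (hassoc z a x).symm
  have hrel : ∀ (a : G) (y : Option G), rel δ a y → rel δ (mul z a) y := by
    rintro a (_ | y) h
    · trivial
    · exact hli a y z h
  rw [Set.image_subset_iff]
  refine fun s hs K ⟨hK, hHK⟩ => hs {a | mul z a ∈ K} ⟨?_, fun a ha => hHK ⟨a, ha, rfl⟩⟩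
  intro x y t a u v w h₁ h₂ h₃ h₄
  refine hK x y t (mul z a) (mul z u) (mul z v) (mul z w) ?_ ?_ ?_ ?_
  · simpa only [hact, hdist] using hrel _ _ h₁
  · have h := congrArg (mul z) h₂
    simpa only [sle, hact, hdist] using h
  · simpa only [Set.mem_ofPred_eq, hdist] using h₃
  · simpa only [Set.mem_ofPred_eq, hact, hdist] using h₄
end

section
/- Let χ be any left regular and right negative quasi-order on G (write g₁ ⊏ g₂ for (g₁,g₂) ∈ χ) which contains the semilattice order ≤ and satisfies: (i) g₁ ⊢ g₂ implies g₁ ⊏ g₁g₂; and (ii) g ⊏ g₁⋏g₂ and g ⊏ (g₂⋏g₃)x imply g ⊏ (g₁⋏g₂⋏g₃)x for all g,g₁,g₂,g₃ ∈ G and x ∈ G* (including the version with the factor x absent). Then for every g ∈ G the χ-class χ⟨g⟩ = {z ∈ G : g ⊏ z} is an f-closed subset of G. -/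
/-- If `χ` is a left regular and right negative quasi-order on `G` containing the
semilattice order `≤` and satisfying (i) `g₁ ⊢ g₂ → g₁ ⊏ g₁g₂` and (ii)
`g ⊏ g₁⋏g₂` and `g ⊏ (g₂⋏g₃)x` imply `g ⊏ (g₁⋏g₂⋏g₃)x` for all `x ∈ G*` (including
the version with the factor `x` absent), then every χ-class `χ⟨g⟩ = {z : g ⊏ z}` is
f-closed. -/
theorem statement_16 {G : Type*} (mul meet : G → G → G) (δ : G → G → Prop)
    (hassoc : ∀ a b c, mul (mul a b) c = mul a (mul b c))
    (hcomm : ∀ a b, meet a b = meet b a)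
    (hmassoc : ∀ a b c, meet (meet a b) c = meet a (meet b c))
    (hidem : ∀ a, meet a a = a)
    (hli : ∀ x y u, δ x y → δ (mul u x) y)
    (hdist : ∀ x y z, mul x (meet y z) = meet (mul x y) (mul x z))
    (hmle : ∀ x y z, sle meet (mul (meet x y) z) (mul y z))
    (χ : G → G → Prop)
    (hrefl : ∀ a, χ a a)
    (htrans : ∀ a b c, χ a b → χ b c → χ a c)
    (hlreg : ∀ x a b, χ a b → χ (mul x a) (mul x b))
    (hrneg : ∀ x y u, χ x (mul y u) → χ x y)
    (hcont : ∀ a b, sle meet a b → χ a b)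
    (hi : ∀ g₁ g₂, δ g₁ g₂ → χ g₁ (mul g₁ g₂))
    (hii : ∀ (g g₁ g₂ g₃ : G) (x : Option G), χ g (meet g₁ g₂) →
      χ g (act mul (meet g₂ g₃) x) → χ g (act mul (meet (meet g₁ g₂) g₃) x)) :
    ∀ g : G, FClosed mul meet δ {z | χ g z} := by
  intro g x y t z u v w hxy hle huv hvw
  have hz : χ g (act mul z t) := by
    refine htrans _ _ _ (hii g u v w x huv hvw) (htrans _ _ _ ?_ (hcont _ _ hle))
    cases y with
    | none => exact hrefl _
    | some y => exact hi _ _ hxy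
  cases t with
  | none => exact hz
  | some t => exact hrneg _ _ _ hz
end

section
/- An algebraic system (G,·,⋏,δ), where (G,·) is a semigroup, (G,⋏) is a semilattice and δ is a binary relation on G, is isomorphic to some ∩-semigroup (Φ,∘,∩,δ_Φ) of transformations if and only if: δ is a left-ideal relation on (G,·); x(y⋏z) = xy⋏xz; (x⋏y)z ≤ yz; (x, x⋏y) ∈ χ₀ implies x ≤ y; and (x, xy) ∈ χ₀ implies (x,y) ∈ δ — for all x,y,z ∈ G, where ≤ is the natural order of the semilattice (G,⋏) and χ₀ is the relation (g₁,g₂) ∈ χ₀ ⟺ g₂ ∈ f({g₁}). -/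
universe u

/-- `lact mul x g` is the product `x·g` where `x` ranges over `G* = G ∪ {e}`. -/
def lact {G : Type*} (mul : G → G → G) (x : Option G) (g : G) : G :=
  x.elim g (fun h => mul h g)

/-- The class of `a` modulo the equivalence on `H` identifying `a` and `b` if `a⋏b ∈ H`. -/
def meetClass {G : Type*} (meet : G → G → G) (H : Set G) (a : G) : Set G :=
  {b | meet a b ∈ H}

/-- The sum, over all f-closed sets `H`, of the right translation representations of `G` on
the classes `meetClass meet H`, with a separate point `none` for the class of `e`. -/
def closedRep {G : Type*} (mul meet : G → G → G) (δ : G → G → Prop) (a : G) :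
    Set ((Set G × Option (Set G)) × (Set G × Option (Set G))) :=
  {p | FClosed mul meet δ p.1.1 ∧ p.2.1 = p.1.1 ∧ ∃ x : Option G,
    p.1.2 = x.map (meetClass meet p.1.1) ∧ lact mul x a ∈ p.1.1 ∧
    p.2.2 = some (meetClass meet p.1.1 (lact mul x a))}

section Closure

variable {G : Type*} {mul meet : G → G → G} {δ : G → G → Prop}

theorem subset_fcl (H : Set G) : H ⊆ fcl mul meet δ H :=
  fun _ hx _ hK => hK.2 hx

theorem fclosed_fcl (H : Set G) : FClosed mul meet δ (fcl mul meet δ H) := by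
  intro x y t z u v w h1 h2 h3 h4 K hK
  exact hK.1 x y t z u v w h1 h2 (h3 K hK) (h4 K hK)

namespace FClosed

variable {H : Set G}

theorem mem_of_sle (hH : FClosed mul meet δ H) (hidem : ∀ a, meet a a = a) {a b : G}
    (ha : a ∈ H) (hab : sle meet a b) : b ∈ H := by
  refine hH none none none b a a a trivial ?_ ?_ ?_ <;> simpa [act, hidem]

theorem mem_of_mul_mem (hH : FClosed mul meet δ H) (hidem : ∀ a, meet a a = a) {a b : G}
    (h : mul a b ∈ H) : a ∈ H := by
  refine hH none none (some b) a (mul a b) (mul a b) (mul a b) trivial ?_ ?_ ?_ <;>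
    simp [act, hidem, sle, h]

theorem mul_mem_of_rel (hH : FClosed mul meet δ H) (hidem : ∀ a, meet a a = a) {a b : G}
    (ha : a ∈ H) (hab : δ a b) : mul a b ∈ H := by
  refine hH none (some b) none (mul a b) a a a ?_ ?_ ?_ ?_ <;>
    simp [act, rel, hidem, sle, ha, hab]

theorem left_mem_of_meet_mem (hH : FClosed mul meet δ H) (hcomm : ∀ a b, meet a b = meet b a)
    (hmassoc : ∀ a b c, meet (meet a b) c = meet a (meet b c)) (hidem : ∀ a, meet a a = a)
    {a b : G} (h : meet a b ∈ H) : a ∈ H := by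
  refine hH.mem_of_sle hidem h ?_
  rw [sle, hcomm, ← hmassoc, hidem]

theorem meet_mem_trans (hH : FClosed mul meet δ H) (hcomm : ∀ a b, meet a b = meet b a)
    (hmassoc : ∀ a b c, meet (meet a b) c = meet a (meet b c)) (hidem : ∀ a, meet a a = a)
    {a b c : G} (h : meet a b ∈ H) (h' : meet b c ∈ H) : meet a c ∈ H := by
  refine hH none none none _ a b c trivial ?_ h h'
  simp only [act, sle]
  rw [hmassoc, hmassoc, hcomm a c, ← hmassoc c, hidem, hcomm c a, ← hmassoc b, hcomm b a,
    hmassoc a b c, ← hmassoc a, hidem]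

theorem meet_mul_mem (hH : FClosed mul meet δ H) (hcomm : ∀ a b, meet a b = meet b a)
    (hmassoc : ∀ a b c, meet (meet a b) c = meet a (meet b c)) (hidem : ∀ a, meet a a = a)
    (hright : ∀ x y z, sle meet (mul (meet x y) z) (mul y z))
    {a b c : G} (h : meet a b ∈ H) (hac : mul a c ∈ H) : meet (mul a c) (mul b c) ∈ H := by
  refine hH (some c) none none _ b a a trivial ?_ (hcomm a b ▸ h) (by simpa [act, hidem])
  have h1 := hright b a c
  have h2 := hright a b c
  rw [hcomm a b] at h2
  simp only [act, sle] at *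
  rw [hmassoc b a a, hidem, ← hmassoc, h1, h2]

theorem meetClass_eq_iff (hH : FClosed mul meet δ H) (hcomm : ∀ a b, meet a b = meet b a)
    (hmassoc : ∀ a b c, meet (meet a b) c = meet a (meet b c)) (hidem : ∀ a, meet a a = a)
    {a b : G} (ha : a ∈ H) :
    meetClass meet H a = meetClass meet H b ↔ meet a b ∈ H := by
  constructor
  · intro h
    have : a ∈ meetClass meet H b := h ▸ (by simpa [meetClass, hidem] using ha)
    exact hcomm a b ▸ this
  · intro h
    ext c
    exact ⟨hH.meet_mem_trans hcomm hmassoc hidem (hcomm a b ▸ h),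
      hH.meet_mem_trans hcomm hmassoc hidem h⟩

theorem meetClass_lact_eq (hH : FClosed mul meet δ H) (hcomm : ∀ a b, meet a b = meet b a)
    (hmassoc : ∀ a b c, meet (meet a b) c = meet a (meet b c)) (hidem : ∀ a, meet a a = a)
    (hright : ∀ x y z, sle meet (mul (meet x y) z) (mul y z)) {x y : Option G} {a : G}
    (hxy : x.map (meetClass meet H) = y.map (meetClass meet H)) (hx : lact mul x a ∈ H) :
    meetClass meet H (lact mul x a) = meetClass meet H (lact mul y a) := by
  rcases x with _ | x <;> rcases y with _ | y <;> simp only [Option.map, reduceCtorEq] at hxy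
  · rfl
  · have hx' : mul x a ∈ H := hx
    have h := (hH.meetClass_eq_iff hcomm hmassoc hidem (hH.mem_of_mul_mem hidem hx')).1
      (Option.some.inj hxy)
    exact (hH.meetClass_eq_iff hcomm hmassoc hidem hx).2
      (hH.meet_mul_mem hcomm hmassoc hidem hright h hx')

end FClosed

theorem mem_of_meetClass_eq {H : Set G} (hH : FClosed mul meet δ H)
    (hcomm : ∀ a b, meet a b = meet b a)
    (hmassoc : ∀ a b c, meet (meet a b) c = meet a (meet b c)) (hidem : ∀ a, meet a a = a)
    {a b : G} (ha : a ∈ H) (h : meetClass meet H a = meetClass meet H b) : b ∈ H :=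
  hH.left_mem_of_meet_mem hcomm hmassoc hidem
    (hcomm a b ▸ (hH.meetClass_eq_iff hcomm hmassoc hidem ha).1 h)

theorem isTransformation_closedRep
    (hcomm : ∀ a b, meet a b = meet b a)
    (hmassoc : ∀ a b c, meet (meet a b) c = meet a (meet b c))
    (hidem : ∀ a, meet a a = a)
    (hright : ∀ x y z, sle meet (mul (meet x y) z) (mul y z))
    (a : G) : IsTransformation (closedRep mul meet δ a) := by
  rintro ⟨H, p⟩ ⟨K, q⟩ ⟨L, r⟩ ⟨hH, hK, x, hx, hxa, hq⟩ ⟨-, hL, y, hy, -, hr⟩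
  dsimp only at *
  subst hK hL hq hr
  rw [hH.meetClass_lact_eq hcomm hmassoc hidem hright (hx.symm.trans hy) hxa]

theorem closedRep_mul
    (hassoc : ∀ a b c, mul (mul a b) c = mul a (mul b c))
    (hcomm : ∀ a b, meet a b = meet b a)
    (hmassoc : ∀ a b c, meet (meet a b) c = meet a (meet b c))
    (hidem : ∀ a, meet a a = a)
    (hright : ∀ x y z, sle meet (mul (meet x y) z) (mul y z))
    (a b : G) : closedRep mul meet δ (mul a b) =
    comp (closedRep mul meet δ b) (closedRep mul meet δ a) := by
  have hl : ∀ x, lact mul x (mul a b) = mul (lact mul x a) b := by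
    rintro (_ | x) <;> simp [lact, hassoc]
  ext ⟨⟨H, p⟩, ⟨K, q⟩⟩
  constructor
  · rintro ⟨hH, hK, x, hx, hxa, hq⟩
    dsimp only at *
    rw [hl] at hxa hq
    exact ⟨(H, some (meetClass meet H (lact mul x a))),
      ⟨hH, rfl, x, hx, hH.mem_of_mul_mem hidem hxa, rfl⟩,
      ⟨hH, hK, some (lact mul x a), rfl, hxa, hq⟩⟩
  · rintro ⟨⟨L, r⟩, ⟨hH, hL, x, hx, hxa, hr⟩, ⟨-, hK, y, hy, hyb, hq⟩⟩
    dsimp only at *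
    subst hL hK hr hq
    have h := hH.meetClass_lact_eq hcomm hmassoc hidem hright
      (y := some (lact mul x a)) hy.symm hyb
    refine ⟨hH, rfl, x, hx, ?_, ?_⟩
    · dsimp only
      rw [hl]
      exact mem_of_meetClass_eq hH hcomm hmassoc hidem hyb h
    · dsimp only
      rw [hl, h]
      rfl

theorem closedRep_meet
    (hcomm : ∀ a b, meet a b = meet b a)
    (hmassoc : ∀ a b c, meet (meet a b) c = meet a (meet b c))
    (hidem : ∀ a, meet a a = a)
    (hleft : ∀ x y z, mul x (meet y z) = meet (mul x y) (mul x z))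
    (hright : ∀ x y z, sle meet (mul (meet x y) z) (mul y z))
    (a b : G) : closedRep mul meet δ (meet a b) =
    closedRep mul meet δ a ∩ closedRep mul meet δ b := by
  have hl : ∀ x, lact mul x (meet a b) = meet (lact mul x a) (lact mul x b) := by
    rintro (_ | x) <;> simp [lact, hleft]
  ext ⟨⟨H, p⟩, ⟨K, q⟩⟩
  constructor
  · rintro ⟨hH, hK, x, hx, hxab, hq⟩
    dsimp only at *
    rw [hl] at hxab hq
    have hxa := hH.left_mem_of_meet_mem hcomm hmassoc hidem hxab
    have hxb := hH.left_mem_of_meet_mem hcomm hmassoc hidem (hcomm _ (lact mul x b) ▸ hxab)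
    refine ⟨⟨hH, hK, x, hx, hxa, hq.trans (congrArg some ?_)⟩,
      ⟨hH, hK, x, hx, hxb, hq.trans (congrArg some ?_)⟩⟩
    · refine (hH.meetClass_eq_iff hcomm hmassoc hidem hxab).2 ?_
      rwa [hcomm, ← hmassoc, hidem]
    · refine (hH.meetClass_eq_iff hcomm hmassoc hidem hxab).2 ?_
      rwa [hmassoc, hidem]
  · rintro ⟨⟨hH, hK, x, hx, hxa, hq⟩, ⟨-, -, y, hy, hyb, hq'⟩⟩
    dsimp only at *
    have hyx := hH.meetClass_lact_eq hcomm hmassoc hidem hright (hy.symm.trans hx) hyb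
    have hxab := (hH.meetClass_eq_iff hcomm hmassoc hidem hxa).1
      ((Option.some.inj (hq.symm.trans hq')).trans hyx)
    refine ⟨hH, hK, x, hx, ?_, hq.trans (congrArg some ?_)⟩
    · dsimp only
      rwa [hl]
    · refine (hH.meetClass_eq_iff hcomm hmassoc hidem hxa).2 ?_
      rwa [hl, ← hmassoc, hidem]

theorem pr2_closedRep_subset
    (hidem : ∀ a, meet a a = a)
    (hδ : ∀ x y u, δ x y → δ (mul u x) y) {a b : G} (hab : δ a b) :
    pr2 (closedRep mul meet δ a) ⊆ pr1 (closedRep mul meet δ b) := by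
  rintro ⟨K, q⟩ ⟨⟨H, p⟩, hH, hK, x, hx, hxa, hq⟩
  dsimp only at *
  subst hK hq
  have hrel : δ (lact mul x a) b := by
    rcases x with _ | x
    · exact hab
    · exact hδ _ _ _ hab
  exact ⟨(K, some (meetClass meet K (mul (lact mul x a) b))), hH, rfl, some (lact mul x a), rfl,
    hH.mul_mem_of_rel hidem hxa hrel, rfl⟩

theorem mul_mem_fcl_of_pr2_subset
    (hcomm : ∀ a b, meet a b = meet b a)
    (hmassoc : ∀ a b c, meet (meet a b) c = meet a (meet b c))
    (hidem : ∀ a, meet a a = a)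
    (hright : ∀ x y z, sle meet (mul (meet x y) z) (mul y z))
    {a b : G}
    (h : pr2 (closedRep mul meet δ a) ⊆ pr1 (closedRep mul meet δ b)) :
    mul a b ∈ fcl mul meet δ {a} := by
  have hH := fclosed_fcl (mul := mul) (meet := meet) (δ := δ) {a}
  have ha : a ∈ fcl mul meet δ {a} := subset_fcl {a} rfl
  obtain ⟨q, -, -, y, hy, hyb, -⟩ := h
    (a := (fcl mul meet δ {a}, some (meetClass meet (fcl mul meet δ {a}) a)))
    ⟨(fcl mul meet δ {a}, none), hH, rfl, none, rfl, ha, rfl⟩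
  dsimp only at *
  exact mem_of_meetClass_eq hH hcomm hmassoc hidem hyb
    (hH.meetClass_lact_eq hcomm hmassoc hidem hright (y := some a) hy.symm hyb)

theorem meet_mem_fcl_of_closedRep_subset
    (hcomm : ∀ a b, meet a b = meet b a)
    (hmassoc : ∀ a b c, meet (meet a b) c = meet a (meet b c))
    (hidem : ∀ a, meet a a = a)
    {a b : G}
    (h : closedRep mul meet δ a ⊆ closedRep mul meet δ b) :
    meet a b ∈ fcl mul meet δ {a} := by
  have hH := fclosed_fcl (mul := mul) (meet := meet) (δ := δ) {a}
  have ha : a ∈ fcl mul meet δ {a} := subset_fcl {a} rfl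
  obtain ⟨-, -, y, hy, -, hq⟩ := h (a := ((fcl mul meet δ {a}, none),
    (fcl mul meet δ {a}, some (meetClass meet (fcl mul meet δ {a}) a))))
    ⟨hH, rfl, none, rfl, ha, rfl⟩
  dsimp only at *
  obtain rfl : y = none := Option.map_eq_none_iff.1 hy.symm
  exact (hH.meetClass_eq_iff hcomm hmassoc hidem ha).1 (Option.some.inj hq)

theorem fclosed_setOf_mem_pr1
    {A : Type*} {P : G → Set (A × A)} (hT : ∀ g, IsTransformation (P g))
    (hmul : ∀ a b, P (mul a b) = comp (P b) (P a)) (hmeet : ∀ a b, P (meet a b) = P a ∩ P b)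
    (hδ : ∀ a b, δ a b → pr2 (P a) ⊆ pr1 (P b))
    (a : A) : FClosed mul meet δ {g | a ∈ pr1 (P g)} := by
  rintro x y t z u v w hrel hle ⟨b, hb⟩ hvw
  have hx : a ∈ pr1 (P (act mul (meet (meet u v) w) x)) := by
    rw [hmeet] at hb
    rcases x with _ | x
    · obtain ⟨c, hc⟩ := hvw
      simp only [act, hmeet] at hc ⊢
      obtain rfl := hT v hb.2 hc.1
      exact ⟨b, hb, hc.2⟩
    · obtain ⟨d, hd⟩ := hvw
      simp only [act, hmul, hmeet] at hd ⊢
      obtain ⟨c, hc, hcd⟩ := hd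
      obtain rfl := hT v hb.2 hc.1
      exact ⟨d, b, ⟨hb, hc.2⟩, hcd⟩
  have hy : a ∈ pr1 (P (act mul (act mul (meet (meet u v) w) x) y)) := by
    rcases y with _ | y
    · exact hx
    · obtain ⟨c, hc⟩ := hx
      obtain ⟨d, hd⟩ := hδ _ _ hrel ⟨a, hc⟩
      exact ⟨d, by rw [act, hmul]; exact ⟨c, hc, hd⟩⟩
  obtain ⟨c, hc⟩ := hy
  rw [← hle, hmeet] at hc
  rcases t with _ | t
  · exact ⟨c, hc.2⟩
  · have := hc.2
    rw [act, hmul] at this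
    obtain ⟨d, hd, -⟩ := this
    exact ⟨d, hd⟩

theorem pr1_subset_of_mem_fcl
    {A : Type*} {P : G → Set (A × A)} (hT : ∀ g, IsTransformation (P g))
    (hmul : ∀ a b, P (mul a b) = comp (P b) (P a)) (hmeet : ∀ a b, P (meet a b) = P a ∩ P b)
    (hδ : ∀ a b, δ a b → pr2 (P a) ⊆ pr1 (P b))
    {g h : G} (hh : h ∈ fcl mul meet δ {g}) :
    pr1 (P g) ⊆ pr1 (P h) := fun a ha =>
  hh _ ⟨fclosed_setOf_mem_pr1 hT hmul hmeet hδ a, Set.singleton_subset_iff.2 ha⟩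

end Closure

/-- Main theorem: an algebraic system (G,·,⋏,δ), where (G,·) is a semigroup and
(G,⋏) a semilattice, is isomorphic to some ∩-semigroup (Φ,∘,∩,δ_Φ) of transformations
iff δ is left-ideal, x(y⋏z) = xy⋏xz, (x⋏y)z ≤ yz, (x,x⋏y) ∈ χ₀ → x ≤ y and
(x,xy) ∈ χ₀ → (x,y) ∈ δ, where (g₁,g₂) ∈ χ₀ ⟺ g₂ ∈ f({g₁}). -/
theorem statement_18 {G : Type u} (mul meet : G → G → G) (δ : G → G → Prop)
    (hassoc : ∀ a b c, mul (mul a b) c = mul a (mul b c))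
    (hcomm : ∀ a b, meet a b = meet b a)
    (hmassoc : ∀ a b c, meet (meet a b) c = meet a (meet b c))
    (hidem : ∀ a, meet a a = a) :
    (∃ (A : Type u) (_ : Nonempty A) (Φ : Set (Set (A × A))),
      (∀ f ∈ Φ, IsTransformation f) ∧
      (∀ f ∈ Φ, ∀ g ∈ Φ, comp g f ∈ Φ) ∧
      (∀ f ∈ Φ, ∀ g ∈ Φ, f ∩ g ∈ Φ) ∧
      ∃ P : G → Set (A × A),
        (∀ g, P g ∈ Φ) ∧ Function.Injective P ∧ (∀ f ∈ Φ, ∃ g, P g = f) ∧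
        (∀ a b, P (mul a b) = comp (P b) (P a)) ∧
        (∀ a b, P (meet a b) = P a ∩ P b) ∧
        (∀ a b, δ a b ↔ pr2 (P a) ⊆ pr1 (P b))) ↔
    ((∀ x y u, δ x y → δ (mul u x) y) ∧
     (∀ x y z, mul x (meet y z) = meet (mul x y) (mul x z)) ∧
     (∀ x y z, sle meet (mul (meet x y) z) (mul y z)) ∧
     (∀ x y, meet x y ∈ fcl mul meet δ {x} → sle meet x y) ∧
     (∀ x y, mul x y ∈ fcl mul meet δ {x} → δ x y)) := by
  constructor
  · rintro ⟨A, -, Φ, hΦ, -, -, P, hPΦ, hinj, -, hmul, hmeet, hδ⟩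
    have hT := fun g => hΦ _ (hPΦ g)
    have hdom := fun {g h : G} =>
      pr1_subset_of_mem_fcl (g := g) (h := h) hT hmul hmeet (fun a b => (hδ a b).1)
    refine ⟨?_, ?_, ?_, ?_, ?_⟩
    · intro x y u hxy
      rw [hδ] at hxy ⊢
      rw [hmul]
      rintro b ⟨a, c, -, hcb⟩
      exact hxy ⟨c, hcb⟩
    · intro x y z
      apply hinj
      simp only [hmul, hmeet]
      ext ⟨a, b⟩
      constructor
      · rintro ⟨c, hc, hy, hz⟩
        exact ⟨⟨c, hc, hy⟩, ⟨c, hc, hz⟩⟩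
      · rintro ⟨⟨c, hc, hy⟩, ⟨d, hd, hz⟩⟩
        obtain rfl := hT x hc hd
        exact ⟨c, hc, hy, hz⟩
    · intro x y z
      apply hinj
      simp only [hmul, hmeet]
      refine Set.inter_eq_left.2 ?_
      rintro ⟨a, b⟩ ⟨c, hc, hz⟩
      exact ⟨c, hc.2, hz⟩
    · intro x y hxy
      apply hinj
      refine Set.Subset.antisymm (hmeet x y ▸ Set.inter_subset_left) ?_
      rintro ⟨a, b⟩ hab
      obtain ⟨c, hc⟩ := hdom hxy ⟨b, hab⟩
      have hc' := hc
      rw [hmeet] at hc'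
      obtain rfl := hT x hab hc'.1
      exact hc
    · intro x y hxy
      rw [hδ]
      rintro b ⟨a, hab⟩
      obtain ⟨d, hd⟩ := hdom hxy ⟨b, hab⟩
      rw [hmul] at hd
      obtain ⟨c, hc, hcd⟩ := hd
      obtain rfl := hT x hab hc
      exact ⟨d, hcd⟩
  · rintro ⟨hδ, hleft, hright, hle, hrel⟩
    have hmul := closedRep_mul (δ := δ) hassoc hcomm hmassoc hidem hright
    have hmeet := closedRep_meet (δ := δ) hcomm hmassoc hidem hleft hright
    refine ⟨Set G × Option (Set G), ⟨(∅, none)⟩, Set.range (closedRep mul meet δ), ?_, ?_, ?_,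
      closedRep mul meet δ, Set.mem_range_self, ?_, fun _ h => h, hmul, hmeet, fun a b => ⟨?_, ?_⟩⟩
    · rintro _ ⟨a, rfl⟩
      exact isTransformation_closedRep hcomm hmassoc hidem hright a
    · rintro _ ⟨a, rfl⟩ _ ⟨b, rfl⟩
      exact ⟨mul a b, hmul a b⟩
    · rintro _ ⟨a, rfl⟩ _ ⟨b, rfl⟩
      exact ⟨meet a b, hmeet a b⟩
    · intro a b hab
      have h1 : meet a b = a := hle a b
        (meet_mem_fcl_of_closedRep_subset hcomm hmassoc hidem hab.subset)
      have h2 : meet b a = b := hle b a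
        (meet_mem_fcl_of_closedRep_subset hcomm hmassoc hidem hab.symm.subset)
      rw [← h1, hcomm, h2]
    · exact pr2_closedRep_subset hidem hδ
    · exact fun h => hrel a b (mul_mem_fcl_of_pr2_subset hcomm hmassoc hidem hright h)
end
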